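/- arXiv:2511.16959 — 2 statements merged into one kernel-verified Lean document; each statement's English description precedes it below -/
import Mathlib

section
/- Let n ≥ 4, 2 ≤ k ≤ n-2, and H = ⟨r_n, r_{n-1}, r_k⟩. Then H = Sym_n if and only if one of: (i) n even and k even; (ii) n ≡ 3 (mod 4); (iii) n ≡ 1 (mod 4) and k ≡ 2 or 3 (mod 4). -/
/-- The prefix reversal `r i` on positions `1..n` (0-indexed as `Fin n`):
position `x+1 ↦ i+1-(x+1)` for `x+1 ≤ i`, i.e. `x ↦ i-1-x` for `x < i`, fixing the rest. -/
def pr (n i : ℕ) : Equiv.Perm (Fin n) :=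
  Function.Involutive.toPerm
    (fun x => if h : x.val < i ∧ i ≤ n then ⟨i - 1 - x.val, by omega⟩ else x)
    (by
      intro x
      apply Fin.ext
      dsimp only
      split_ifs with h1 h2 h3 <;> simp_all <;> omega)


theorem pr_val (n i : ℕ) (hi : i ≤ n) (x : Fin n) :
    (pr n i x).val = if x.val < i then i - 1 - x.val else x.val := by
  change (if h : x.val < i ∧ i ≤ n then (⟨i - 1 - x.val, by omega⟩ : Fin n) else x).val = _
  by_cases h : x.val < i
  · simp [h, hi]
  · simp [h]

theorem c_val (n : ℕ) (x : Fin n) :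
    ((pr n n * pr n (n-1)) x).val = if x.val = n - 1 then 0 else x.val + 1 := by
  have := x.isLt
  rw [Equiv.Perm.mul_apply, pr_val n n le_rfl, pr_val n (n-1) (by omega)]
  split_ifs <;> omega

theorem c_pow_val (n : ℕ) (j : ℕ) (x : Fin n) :
    (((pr n n * pr n (n-1))^j) x).val = (x.val + j) % n := by
  have := x.isLt
  induction j with
  | zero => simp [Nat.mod_eq_of_lt this]
  | succ j ih =>
    rw [pow_succ', Equiv.Perm.mul_apply, c_val, ih, ← add_assoc, Nat.add_mod _ 1]
    have hlt := Nat.mod_lt (x.val + j) (show 0 < n by omega)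
    split_ifs with h
    · rw [h]
      rcases Nat.lt_or_ge 1 n with h1 | h1
      · rw [Nat.mod_eq_of_lt h1, Nat.sub_add_cancel (by omega), Nat.mod_self]
      · have : n = 1 := by omega
        subst this; simp
    · rw [Nat.mod_eq_of_lt (show 1 < n by omega)]
      exact (Nat.mod_eq_of_lt (show (x.val + j) % n + 1 < n by omega)).symm

theorem sign_pr (n i : ℕ) (hi : i ≤ n) : Equiv.Perm.sign (pr n i) = (-1)^(i/2) := by
  induction i using Nat.strong_induction_on with
  | _ i ih =>
    match i with
    | 0 =>
      have : pr n 0 = 1 := by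
        ext x; rw [pr_val n 0 hi]; simp
      simp [this]
    | 1 =>
      have : pr n 1 = 1 := by
        ext x; rw [pr_val n 1 hi]; simp; omega
      simp [this]
    | i + 2 =>
      have h := ih i (by omega) (by omega)
      have key : pr n (i+2) * Equiv.swap ⟨0, by omega⟩ ⟨i+1, by omega⟩ * (pr n n * pr n (n-1))
          = (pr n n * pr n (n-1)) * pr n i := by
        have hc := c_val n
        generalize pr n n * pr n (n-1) = C at hc ⊢
        ext x
        have hx := x.isLt
        have e := hc x
        have e3 := pr_val n i (by omega) x
        rw [Equiv.Perm.mul_apply, Equiv.Perm.mul_apply, Equiv.Perm.mul_apply, hc, e3,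
          pr_val n (i+2) hi, Equiv.swap_apply_def]
        generalize C x = y at e ⊢
        simp only [Fin.ext_iff, apply_ite Fin.val]
        clear e3 hc
        split_ifs at * <;> omega
      have := congrArg Equiv.Perm.sign key
      rw [map_mul, map_mul, map_mul _ _ (pr n i), mul_comm, Equiv.Perm.sign_swap (by simp)] at this
      have := mul_left_cancel this
      rw [h] at this
      rw [show (i+2)/2 = i/2+1 by omega, pow_succ, ← this]; simp

theorem rho_val (n k : ℕ) (hk : k + 2 ≤ n) (hk1 : 2 ≤ k) (j : ℕ) (x : Fin n) :
    (((((pr n n * pr n (n-1)) * pr n k * (pr n n * pr n (n-1))⁻¹) * pr n k) ^ j) x).val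
      = if x.val < k + 1 then (x.val + 2 * j) % (k+1) else x.val := by
  have e1 (y : Fin n) : (((pr n n * pr n (n-1)) * pr n k * (pr n n * pr n (n-1))⁻¹) y).val =
      if 1 ≤ y.val ∧ y.val < k + 1 then k + 1 - y.val else y.val := by
    obtain ⟨z, rfl⟩ := (pr n n * pr n (n-1)).surjective y
    have hz : (pr n n * pr n (n-1) * pr n k * (pr n n * pr n (n-1))⁻¹) ((pr n n * pr n (n-1)) z)
        = (pr n n * pr n (n-1)) (pr n k z) := by
      rw [← Equiv.Perm.mul_apply, ← Equiv.Perm.mul_apply, inv_mul_cancel_right]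
    rw [hz, c_val, c_val,
      pr_val n k (by omega)]
    have := z.isLt
    split_ifs <;> omega
  induction j with
  | zero =>
    simp only [pow_zero, Equiv.Perm.coe_one, id_eq, mul_zero, add_zero]
    split_ifs with h
    · rw [Nat.mod_eq_of_lt h]
    · rfl
  | succ j ih =>
    rw [pow_succ', Equiv.Perm.mul_apply, Equiv.Perm.mul_apply _ (pr n k), e1, pr_val n k (by omega), ih]
    have hx := x.isLt
    by_cases h : x.val < k + 1
    · simp only [h, if_true]
      rw [show x.val + 2 * (j+1) = (x.val + 2 * j) + 2 by ring, Nat.add_mod _ 2,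
        Nat.mod_eq_of_lt (show 2 < k+1 by omega)]
      have := Nat.mod_lt (x.val + 2 * j) (show 0 < k+1 by omega)
      generalize (x.val + 2 * j) % (k+1) = t at *
      rcases Nat.lt_or_ge (t+2) (k+1) with h2 | h2
      · rw [Nat.mod_eq_of_lt h2]; split_ifs <;> omega
      · rw [Nat.mod_eq_sub_mod h2, Nat.mod_eq_of_lt (by omega)]; split_ifs <;> omega
    · simp only [h, if_false]
      split_ifs <;> omega

theorem block_step {α : Type*} {G : Subgroup (Equiv.Perm α)} {B : Set α}
    (hB : MulAction.IsBlock G B) {g : Equiv.Perm α} (hg : g ∈ G) {x z : α}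
    (hx : x ∈ B) (hgx : g x ∈ B) (hz : z ∈ B) : g z ∈ B := by
  have h := (MulAction.isBlock_iff_smul_eq_of_nonempty.1 hB) (g := (⟨g, hg⟩ : G))
    ⟨g x, ⟨x, hx, rfl⟩, hgx⟩
  rw [← h]
  exact ⟨z, hz, rfl⟩

theorem alt_le (n k : ℕ) (hk : k + 2 ≤ n) (hk1 : 2 ≤ k) (hke : k % 2 = 0)
    (G : Subgroup (Equiv.Perm (Fin n))) (h1 : pr n n ∈ G) (h2 : pr n (n-1) ∈ G)
    (h3 : pr n k ∈ G) : alternatingGroup (Fin n) ≤ G := by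
  have hC := mul_mem h1 h2
  have hR := pow_mem (mul_mem (mul_mem (mul_mem hC h3) (inv_mem hC)) h3) (k/2+1)
  have hRv := rho_val n k hk hk1 (k/2+1)
  have hCv := c_val n
  have hCp := c_pow_val n
  generalize (((pr n n * pr n (n-1)) * pr n k * (pr n n * pr n (n-1))⁻¹) * pr n k)
    ^ (k/2+1) = σ at hR hRv
  generalize pr n n * pr n (n-1) = C at *
  have hσ (x : Fin n) : (σ x).val = if x.val < k then x.val + 1 else if x.val = k then 0
      else x.val := by
    rw [hRv]
    split_ifs with a b c
    · rw [show x.val + 2 * (k/2+1) = x.val + 1 + (k+1) by omega, Nat.add_mod_right,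
        Nat.mod_eq_of_lt (by omega)]
    · rw [show x.val + 2 * (k/2+1) = 0 + (k+1) + (k+1) by omega, Nat.add_mod_right,
        Nat.add_mod_right, Nat.zero_mod]
    all_goals omega
  set p0 : Fin n := ⟨0, by omega⟩ with hp0
  set pk : Fin n := ⟨k, by omega⟩ with hpk
  set pk1 : Fin n := ⟨k+1, by omega⟩ with hpk1
  have n1 : p0 ≠ pk1 := by simp [hp0, hpk1, Fin.ext_iff]
  have n2 : p0 ≠ pk := by simp [hp0, hpk, Fin.ext_iff]; omega
  have n3 : pk1 ≠ pk := by simp [hpk1, hpk, Fin.ext_iff]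
  have hτ3 := Equiv.Perm.isThreeCycle_swap_mul_swap_same n1 n2 n3
  have t0 : (Equiv.swap p0 pk1 * Equiv.swap p0 pk) p0 = pk := by
    rw [Equiv.Perm.mul_apply, Equiv.swap_apply_left, Equiv.swap_apply_of_ne_of_ne n2.symm n3.symm]
  have tk : (Equiv.swap p0 pk1 * Equiv.swap p0 pk) pk = pk1 := by
    rw [Equiv.Perm.mul_apply, Equiv.swap_apply_right, Equiv.swap_apply_left]
  have tk1 : (Equiv.swap p0 pk1 * Equiv.swap p0 pk) pk1 = p0 := by
    rw [Equiv.Perm.mul_apply, Equiv.swap_apply_of_ne_of_ne n1.symm n3, Equiv.swap_apply_right]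
  have tf (x) (a : x ≠ p0) (b : x ≠ pk) (c : x ≠ pk1) :
      (Equiv.swap p0 pk1 * Equiv.swap p0 pk) x = x := by
    rw [Equiv.Perm.mul_apply, Equiv.swap_apply_of_ne_of_ne a b, Equiv.swap_apply_of_ne_of_ne a c]
  generalize Equiv.swap p0 pk1 * Equiv.swap p0 pk = τ at *
  have key : C * σ = σ * τ * C := by
    ext x
    have hx := x.isLt
    rw [Equiv.Perm.mul_apply, Equiv.Perm.mul_apply, Equiv.Perm.mul_apply, hCv, hσ, hσ]
    have hcx := hCv x
    by_cases e0 : C x = p0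
    · rw [e0] at hcx ⊢
      rw [t0]
      simp only [hp0, hpk] at *
      split_ifs at * <;> omega
    by_cases ek : C x = pk
    · rw [ek] at hcx ⊢
      rw [tk]
      simp only [hpk1, hpk] at *
      split_ifs at * <;> omega
    by_cases ek1 : C x = pk1
    · rw [ek1] at hcx ⊢
      rw [tk1]
      simp only [hp0, hpk1] at *
      split_ifs at * <;> omega
    rw [tf _ e0 ek ek1]
    simp only [hp0, hpk, hpk1, Fin.ext_iff] at e0 ek ek1
    split_ifs at * <;> omega
  have hτ : τ ∈ G := by
    have : τ = σ⁻¹ * (C * σ) * C⁻¹ := by rw [key]; group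
    rw [this]
    exact mul_mem (mul_mem (inv_mem hR) (mul_mem hC hR)) (inv_mem hC)
  have hCk : C pk = pk1 := by
    ext; rw [hCv]; simp only [hpk, hpk1]; split_ifs <;> omega
  have htr (x y : Fin n) : ∃ j : ℕ, (C ^ j) x = y := by
    refine ⟨n - x.val + y.val, ?_⟩
    ext
    rw [hCp, show x.val + (n - x.val + y.val) = y.val + n by omega, Nat.add_mod_right,
      Nat.mod_eq_of_lt y.isLt]
  refine Equiv.Perm.alternatingGroup_le_of_isPreprimitive_of_isThreeCycle_mem ?_ hτ3 hτ
  have : MulAction.IsPretransitive G (Fin n) := ⟨fun x y => by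
    obtain ⟨j, hj⟩ := htr x y
    exact ⟨⟨C ^ j, pow_mem hC j⟩, hj⟩⟩
  refine { isTrivialBlock_of_isBlock := ?_ }
  intro B hB
  by_cases hs : B.Subsingleton
  · exact Or.inl hs
  right
  rw [Set.not_subsingleton_iff] at hs
  have step : ∀ b ∈ B, C b ∈ B := by
    intro b hb
    obtain ⟨y, hy, hyb⟩ := hs.exists_ne b
    obtain ⟨j, hj⟩ := htr pk b
    have hh : C ^ j ∈ G := pow_mem hC j
    have hcomm : (C ^ j) pk1 = C b := by
      rw [← hCk, ← hj, ← Equiv.Perm.mul_apply, ← Equiv.Perm.mul_apply, ← pow_succ, ← pow_succ']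
    have hconj : C ^ j * τ * (C ^ j)⁻¹ ∈ G := mul_mem (mul_mem hh hτ) (inv_mem hh)
    have hval (z : Fin n) : (C ^ j * τ * (C ^ j)⁻¹) ((C ^ j) z) = (C ^ j) (τ z) := by
      simp [Equiv.Perm.mul_apply]
    obtain ⟨z, rfl⟩ := (C ^ j).surjective y
    have hcb : (C ^ j * τ * (C ^ j)⁻¹) b = C b := by rw [← hj, hval, tk, hcomm, hj]
    rw [← hcb]
    by_cases z1 : z = pk1
    · rw [hcb, ← hcomm, ← z1]; exact hy
    have zk : z ≠ pk := fun h => hyb (by rw [h, hj])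
    refine block_step hB hconj hy ?_ hb
    rw [hval]
    by_cases z0 : z = p0
    · rw [z0, t0, hj]; exact hb
    · rw [tf z z0 zk z1]; exact hy
  obtain ⟨b, hb⟩ := hs.nonempty
  ext y
  simp only [Set.mem_univ, iff_true]
  obtain ⟨j, rfl⟩ := htr b y
  induction j with
  | zero => exact hb
  | succ j ih => rw [pow_succ', Equiv.Perm.mul_apply]; exact step _ ih

theorem pr_sub_mem (n k : ℕ) (hk : k ≤ n) 
    (G : Subgroup (Equiv.Perm (Fin n))) (h1 : pr n n ∈ G) (h2 : pr n (n-1) ∈ G)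
    (h3 : pr n k ∈ G) : pr n (n - k) ∈ G := by
  have key : (pr n n * pr n (n-1)) ^ k * pr n (n - k) = pr n k * pr n n := by
    ext x
    have hx := x.isLt
    rw [Equiv.Perm.mul_apply, Equiv.Perm.mul_apply, c_pow_val, pr_val _ _ hk, pr_val _ _ le_rfl,
      pr_val _ _ (Nat.sub_le _ _)]
    simp only [hx, if_true]
    split_ifs
    · omega
    · rw [Nat.mod_eq_of_lt (by omega)]; omega
    · rw [Nat.mod_eq_sub_mod (by omega), Nat.mod_eq_of_lt (by omega)]; omega
    · omega
  have : pr n (n-k) = ((pr n n * pr n (n-1)) ^ k)⁻¹ * (pr n k * pr n n) := by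
    rw [← key]; group
  rw [this]
  exact mul_mem (inv_mem (pow_mem (mul_mem h1 h2) k)) (mul_mem h3 h1)

theorem top_of_alt (n : ℕ) (G : Subgroup (Equiv.Perm (Fin n)))
    (h : alternatingGroup (Fin n) ≤ G) (i : ℕ) (hi : i ≤ n) (ho : i / 2 % 2 = 1)
    (hm : pr n i ∈ G) : G = ⊤ := by
  have hs : Equiv.Perm.sign (pr n i) = -1 := by
    rw [sign_pr n i hi]; exact Odd.neg_one_pow (Nat.odd_iff.2 ho)
  rw [eq_top_iff]
  intro g _
  rcases Int.units_eq_one_or (Equiv.Perm.sign g) with hg | hg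
  · exact h (Equiv.Perm.mem_alternatingGroup.2 hg)
  · have : pr n i * g ∈ G := h (Equiv.Perm.mem_alternatingGroup.2 (by rw [map_mul, hs, hg]; simp))
    exact (Subgroup.mul_mem_cancel_left G hm).1 this

theorem parity_not_top (n k : ℕ) (hn : 4 ≤ n) (hk : k ≤ n) (hne : n % 2 = 0) (hko : k % 2 = 1) :
    Subgroup.closure ({pr n n, pr n (n - 1), pr n k} : Set (Equiv.Perm (Fin n))) ≠ ⊤ := by
  intro htop
  have hP : ∀ g ∈ Subgroup.closure ({pr n n, pr n (n - 1), pr n k} : Set (Equiv.Perm (Fin n))),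
      ∀ x y : Fin n, (x.val % 2 = y.val % 2 ↔ (g x).val % 2 = (g y).val % 2) := by
    intro g hg
    induction hg using Subgroup.closure_induction with
    | mem g hg =>
      intro x y
      have := x.isLt
      have := y.isLt
      rcases hg with rfl | rfl | rfl
      · rw [pr_val _ _ le_rfl, pr_val _ _ le_rfl]; split_ifs <;> omega
      · rw [pr_val _ _ (Nat.sub_le _ _), pr_val _ _ (Nat.sub_le _ _)]; split_ifs <;> omega
      · rw [pr_val _ _ hk, pr_val _ _ hk]; split_ifs <;> omega
    | one => intro x y; rfl
    | mul a b _ _ iha ihb => intro x y; exact (ihb x y).trans (iha _ _)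
    | inv a _ iha =>
      intro x y
      have := iha (a⁻¹ x) (a⁻¹ y)
      rw [← Equiv.Perm.mul_apply, ← Equiv.Perm.mul_apply, mul_inv_cancel] at this
      exact this.symm
  rw [htop] at hP
  have := hP (pr n 2) trivial ⟨0, by omega⟩ ⟨2, by omega⟩
  rw [pr_val _ _ (by omega), pr_val _ _ (by omega)] at this
  simp at this

theorem sign_not_top (n k : ℕ) (hn : n % 4 = 1) (hn4 : 4 ≤ n) (hk : k ≤ n) (hk2 : k / 2 % 2 = 0) :
    Subgroup.closure ({pr n n, pr n (n - 1), pr n k} : Set (Equiv.Perm (Fin n))) ≠ ⊤ := by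
  intro htop
  have hle : Subgroup.closure ({pr n n, pr n (n - 1), pr n k} : Set (Equiv.Perm (Fin n))) ≤
      alternatingGroup (Fin n) := by
    rw [Subgroup.closure_le]
    rintro g (rfl | rfl | rfl) <;>
      rw [SetLike.mem_coe, Equiv.Perm.mem_alternatingGroup, sign_pr _ _ (by omega)] <;>
      exact Even.neg_one_pow (Nat.even_iff.2 (by omega))
  rw [htop] at hle
  have := Equiv.Perm.mem_alternatingGroup.1 (hle (show pr n 2 ∈ _ from trivial))
  rw [sign_pr _ _ (by omega)] at this
  simp at this

theorem stmt17 (n k : ℕ) (hn : 4 ≤ n) (hk1 : 2 ≤ k) (hk2 : k ≤ n - 2) :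
    Subgroup.closure ({pr n n, pr n (n - 1), pr n k} : Set (Equiv.Perm (Fin n))) = ⊤ ↔
      (n % 2 = 0 ∧ k % 2 = 0) ∨ n % 4 = 3 ∨ (n % 4 = 1 ∧ (k % 4 = 2 ∨ k % 4 = 3)) := by
  constructor
  · intro htop
    by_contra hcon
    by_cases he : n % 2 = 0
    · exact parity_not_top n k hn (by omega) he (by omega) htop
    · exact sign_not_top n k (by omega) hn (by omega) (by omega) htop
  · intro h
    have h1 : pr n n ∈ Subgroup.closure ({pr n n, pr n (n - 1), pr n k} : Set (Equiv.Perm (Fin n))) :=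
      Subgroup.subset_closure (by simp)
    have h2 : pr n (n-1) ∈
        Subgroup.closure ({pr n n, pr n (n - 1), pr n k} : Set (Equiv.Perm (Fin n))) :=
      Subgroup.subset_closure (by simp)
    have h3 : pr n k ∈ Subgroup.closure ({pr n n, pr n (n - 1), pr n k} : Set (Equiv.Perm (Fin n))) :=
      Subgroup.subset_closure (by simp)
    generalize Subgroup.closure ({pr n n, pr n (n - 1), pr n k} : Set (Equiv.Perm (Fin n))) = G at *
    have hA : alternatingGroup (Fin n) ≤ G := by
      by_cases hke : k % 2 = 0
      · exact alt_le n k (by omega) hk1 hke G h1 h2 h3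
      · exact alt_le n (n-k) (by omega) (by omega) (by omega) G h1 h2
          (pr_sub_mem n k (by omega) G h1 h2 h3)
    by_cases c1 : n / 2 % 2 = 1
    · exact top_of_alt n G hA n le_rfl c1 h1
    by_cases c2 : (n-1) / 2 % 2 = 1
    · exact top_of_alt n G hA (n-1) (by omega) c2 h2
    · exact top_of_alt n G hA k (by omega) (by omega) h3
end

section
/- Let n ≥ 5 and 2 ≤ k < n-2. Then ⟨r_n, r_{n-2}, r_k⟩ = Sym_n if and only if n and k have different parities. -/
open Equiv Equiv.Perm in
theorem comm_three {α : Type*} [DecidableEq α] (f g : Perm α) (p : α)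
    (hf : f p ≠ p) (hg : g p ≠ p) (h : ∀ x, x ≠ p → f x = x ∨ g x = x) :
    f * g * f⁻¹ * g⁻¹ = swap p (g p) * swap p (f p) := by
  have e : f * g = swap p (g p) * swap p (f p) * g * f := by
    have hfp : g (f p) = f p := (h (f p) hf).resolve_left (fun h' => hf (f.injective h'))
    have hgp : f (g p) = g p := (h (g p) hg).resolve_right (fun h' => hg (g.injective h'))
    have hne : f p ≠ g p := fun h' => hf (f.injective (by rw [h', hgp]))
    ext x
    simp only [Perm.mul_apply]
    by_cases hx : x = p
    · subst hx
      rw [hfp, hgp, swap_apply_right, swap_apply_left]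
    · by_cases h1 : f x = p
      · have h2 : g x = x := (h x hx).resolve_left (fun h' => hx (by rw [← h1, h']))
        rw [h2, h1, swap_apply_of_ne_of_ne hg hne.symm, swap_apply_right]
      · by_cases h2 : g x = p
        · have h3 : f x = x := (h x hx).resolve_right (fun h' => hx (by rw [← h2, h']))
          rw [h3, h2, swap_apply_left, swap_apply_of_ne_of_ne hf hne]
        · have h3 : f (g x) = g (f x) := by
            rcases h x hx with h3 | h3
            · rw [h3]
              rcases h (g x) h2 with h4 | h4
              · exact h4
              · rw [g.injective h4, h3]
            · rw [h3]
              rcases h (f x) h1 with h4 | h4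
              · rw [f.injective h4, h3]
              · exact h4.symm
          have h4 : g (f x) ≠ p := by
            intro h5
            rcases h x hx with h6 | h6
            · rw [h6] at h5; exact h2 h5
            · rw [← h3, h6] at h5; exact h1 h5
          have h5 : g (f x) ≠ f p := by
            intro h5; rw [← h3] at h5; exact h2 (f.injective h5)
          have h6 : g (f x) ≠ g p := by
            intro h6; exact h1 (g.injective h6)
          rw [swap_apply_of_ne_of_ne h4 h5, swap_apply_of_ne_of_ne h4 h6, h3]
  rw [e]; group

open Equiv Equiv.Perm MulAction Pointwise in
theorem key {α : Type*} [Fintype α] [DecidableEq α] (G : Subgroup (Perm α)) (f g s : Perm α) (p : α)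
    (hfG : f ∈ G) (hgG : g ∈ G) (hsG : s ∈ G) (hs : sign s = -1)
    (hf : f p ≠ p) (hg : g p ≠ p) (h : ∀ x, x ≠ p → f x = x ∨ g x = x)
    (hB : ∀ B : Set α, (∀ t ∈ G, ∀ x ∈ B, t x ∈ B → ∀ y ∈ B, t y ∈ B) → p ∈ B → f p ∈ B →
      g p ∈ B → ∀ x, x ∈ B) : G = ⊤ := by
  have hτ := comm_three f g p hf hg h
  have hτG : swap p (g p) * swap p (f p) ∈ G := by
    rw [← hτ]
    exact G.mul_mem (G.mul_mem (G.mul_mem hfG hgG) (G.inv_mem hfG)) (G.inv_mem hgG)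
  have hgp : f (g p) = g p := (h (g p) hg).resolve_right (fun h' => hg (g.injective h'))
  have hne : f p ≠ g p := fun h' => hf (f.injective (by rw [h', hgp]))
  set τ := swap p (g p) * swap p (f p) with hτd
  have t1 : τ p = f p := by
    simp only [hτd, Perm.mul_apply]
    rw [swap_apply_left, swap_apply_of_ne_of_ne hf hne]
  have t2 : τ (f p) = g p := by
    simp only [hτd, Perm.mul_apply]
    rw [swap_apply_right, swap_apply_left]
  have t3 : τ (g p) = p := by
    simp only [hτd, Perm.mul_apply]
    rw [swap_apply_of_ne_of_ne hg hne.symm, swap_apply_right]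
  have t4 : ∀ x, x ≠ p → x ≠ f p → x ≠ g p → τ x = x := by
    intro x h1 h2 h3
    simp only [hτd, Perm.mul_apply]
    rw [swap_apply_of_ne_of_ne h1 h2, swap_apply_of_ne_of_ne h1 h3]
  have h3 : IsThreeCycle τ := isThreeCycle_swap_mul_swap_same hg.symm hf.symm hne.symm
  have hprim : IsPreprimitive G α := by
    refine IsPreprimitive.of_isTrivialBlock_of_notMem_fixedPoints (a := p) ?_ ?_
    · intro hfix
      exact hf (hfix ⟨f, hfG⟩)
    · intro B hpB hBl
      by_cases hss : B.Subsingleton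
      · left; exact hss
      right
      have hcl : ∀ t ∈ G, ∀ x ∈ B, t x ∈ B → ∀ y ∈ B, t y ∈ B := by
        intro t ht x hx htx y hy
        have := hBl.smul_eq_of_mem (g := (⟨t, ht⟩ : G)) hx htx
        rw [← this]
        exact Set.smul_mem_smul_set hy
      obtain ⟨b, hbB, hbp⟩ : ∃ b ∈ B, b ≠ p := by
        by_contra hcon
        push Not at hcon
        exact hss (fun x hx y hy => by rw [hcon x hx, hcon y hy])
      have hst : ∀ y ∈ B, τ y ∈ B := by
        by_cases b1 : b = f p
        · exact hcl τ hτG p hpB (by rw [t1, ← b1]; exact hbB)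
        by_cases b2 : b = g p
        · exact hcl τ hτG b hbB (by rw [b2, t3]; exact hpB)
        exact hcl τ hτG b hbB (by rw [t4 b hbp b1 b2]; exact hbB)
      have m1 : f p ∈ B := t1 ▸ hst p hpB
      have m2 : g p ∈ B := t2 ▸ hst _ m1
      exact Set.eq_univ_of_forall (hB B hcl hpB m1 m2)
  have hA := alternatingGroup_le_of_isPreprimitive_of_isThreeCycle_mem hprim h3 hτG
  rw [eq_top_iff]
  intro x _
  rcases Int.units_eq_one_or (sign x) with hx | hx
  · exact hA (mem_alternatingGroup.2 hx)
  · have : x * s ∈ G := hA (mem_alternatingGroup.2 (by rw [Perm.sign_mul, hx, hs]; rfl))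
    have h' := G.mul_mem this (G.inv_mem hsG)
    simpa using h'

theorem swap_val {n : ℕ} (a b x : Fin n) : (Equiv.swap a b x).val =
    if x.val = a.val then b.val else if x.val = b.val then a.val else x.val := by
  simp only [Equiv.swap_apply_def, Fin.ext_iff]
  split_ifs <;> rfl

theorem pr_step (n i : ℕ) (hi : i < n) : pr n (i + 1) * pr n i = Fin.cycleRange ⟨i, hi⟩ := by
  ext x
  rw [Equiv.Perm.mul_apply, pr_val n _ (by omega), pr_val n _ (by omega)]
  rcases lt_trichotomy x.val i with h | h | h
  · rw [Fin.coe_cycleRange_of_lt (by exact h)]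
    split_ifs <;> omega
  · have : NeZero n := ⟨by omega⟩
    rw [Fin.cycleRange_of_eq (by ext; exact h)]
    simp only [Fin.val_zero]
    split_ifs <;> omega
  · rw [Fin.cycleRange_of_gt (by exact h)]
    split_ifs <;> omega

theorem pr_sq (n i : ℕ) (hi : i ≤ n) : pr n i * pr n i = 1 := by
  ext x
  rw [Equiv.Perm.mul_apply, pr_val n _ hi, pr_val n _ hi, Equiv.Perm.one_apply]
  split_ifs <;> omega

theorem sign_s (n : ℕ) (hn : 5 ≤ n) : Equiv.Perm.sign (pr n n * pr n (n - 2)) = -1 := by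
  have e1 := pr_step n (n - 1) (by omega)
  have e2 := pr_step n (n - 2) (by omega)
  rw [show n - 1 + 1 = n by omega] at e1
  rw [show n - 2 + 1 = n - 1 by omega] at e2
  have : pr n n * pr n (n - 2) = (pr n n * pr n (n-1)) * (pr n (n-1) * pr n (n-2)) := by
    rw [mul_assoc, ← mul_assoc (pr n (n-1)), pr_sq _ _ (by omega), one_mul]
  rw [this, e1, e2, Equiv.Perm.sign_mul, Fin.sign_cycleRange, Fin.sign_cycleRange, ← pow_add]
  exact Odd.neg_one_pow ⟨n - 2, by simp only; omega⟩

theorem s_val (n : ℕ) (hn : 5 ≤ n) (x : Fin n) : ((pr n n * pr n (n - 2)) x).val =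
    if x.val < n - 2 then x.val + 2 else n - 1 - x.val := by
  rw [Equiv.Perm.mul_apply, pr_val n _ (by omega), pr_val n _ (by omega)]
  have := x.2
  split_ifs <;> omega

set_option maxHeartbeats 1000000 in
open Equiv Equiv.Perm in
theorem odd_case (n k : ℕ) (hn : 5 ≤ n) (hk1 : 2 ≤ k) (hk2 : k < n - 2) (ho : n % 2 = 1)
    (he : k % 2 = 0) (G : Subgroup (Perm (Fin n))) (h1 : pr n n ∈ G) (h2 : pr n (n - 2) ∈ G)
    (h3 : pr n k ∈ G) : G = ⊤ := by
  have hsv := s_val n hn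
  have hsg := sign_s n hn
  have hsG : pr n n * pr n (n - 2) ∈ G := G.mul_mem h1 h2
  set s := pr n n * pr n (n - 2) with hs
  have hpow : ∀ t : ℕ, 2 * t < n → ∀ x : Fin n, ((s ^ t) x).val =
      if x.val + 2 * t < n then x.val + 2 * t else
        if x.val % 2 = 0 then x.val + 2 * t - (n + 1) else x.val + 2 * t - (n - 1) := by
    intro t
    induction t with
    | zero => intro _ x; have := x.2; simp
    | succ t ih =>
      intro ht x
      rw [pow_succ', Perm.mul_apply, hsv, ih (by omega)]
      have := x.2
      split_ifs <;> omega
  set P := s ^ (n / 2) with hP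
  have hPG : P ∈ G := G.pow_mem hsG _
  have hPv : ∀ x : Fin n, (P x).val =
      if x.val % 2 = 0 then (if x.val = 0 then n - 1 else x.val - 2) else x.val := by
    intro x
    rw [hP, hpow _ (by omega)]
    have := x.2
    split_ifs <;> omega
  have hrv := pr_val n k (by omega)
  set r := pr n k with hr
  set Q := r * P * r with hQ
  have hQG : Q ∈ G := G.mul_mem (G.mul_mem h3 hPG) h3
  have hQv : ∀ x : Fin n, (Q x).val =
      if x.val < k then
        (if x.val % 2 = 1 then (if x.val = k - 1 then n - 1 else x.val + 2) else x.val)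
      else if x.val % 2 = 0 then (if x.val = k then 1 else x.val - 2) else x.val := by
    intro x
    rw [hQ, Perm.mul_apply, Perm.mul_apply, hrv, hPv, hrv]
    have := x.2
    split_ifs <;> omega
  set D : Perm (Fin n) := swap ⟨1, by omega⟩ ⟨k - 2, by omega⟩ *
    swap ⟨n - 3, by omega⟩ ⟨n - 1, by omega⟩ with hD
  have hDv : ∀ x : Fin n, (D x).val = if x.val = 1 then k - 2 else if x.val = k - 2 then 1 else
      if x.val = n - 3 then n - 1 else if x.val = n - 1 then n - 3 else x.val := by
    intro x
    rw [hD, Perm.mul_apply, swap_val, swap_val]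
    have := x.2
    simp only
    clear_value D Q P r s
    split_ifs <;> omega
  have hrel : P * Q = D * (Q * P) := by
    clear_value D Q P r s
    have a1 : ∀ x : Fin n, ((P * Q) x).val = if x.val % 2 = 1 then
        (if x.val = k - 1 then n - 3 else if x.val < k then x.val + 2 else x.val)
        else if x.val < k then (if x.val = 0 then n - 1 else x.val - 2)
        else if x.val = k then 1 else x.val - 4 := by
      intro x
      rw [Perm.mul_apply, hPv, hQv]
      have := x.2
      generalize hone : (1 : ℕ) = one
      split_ifs <;> omega
    have a2 : ∀ x : Fin n, ((Q * P) x).val = if x.val % 2 = 1 then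
        (if x.val = k - 1 then n - 1 else if x.val < k then x.val + 2 else x.val)
        else if x.val = 0 then n - 3 else if x.val < k + 2 then x.val - 2
        else if x.val = k + 2 then 1 else x.val - 4 := by
      intro x
      rw [Perm.mul_apply, hQv, hPv]
      have := x.2
      generalize hone : (1 : ℕ) = one
      split_ifs <;> omega
    ext x
    rw [a1, Perm.mul_apply, hDv, a2]
    have := x.2
    clear a1 a2 hDv hQv hPv hrv hpow hsv
    split_ifs <;> omega
  have hDG : D ∈ G := by
    have : D = P * Q * (Q * P)⁻¹ := by rw [hrel]; group
    rw [this]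
    exact G.mul_mem (G.mul_mem hPG hQG) (G.inv_mem (G.mul_mem hQG hPG))
  set O := s * P with hO
  have hOG : O ∈ G := G.mul_mem hsG hPG
  have hOv : ∀ x : Fin n, (O x).val =
      if x.val % 2 = 0 then x.val else if x.val = n - 2 then 1 else x.val + 2 := by
    intro x
    rw [hO, Perm.mul_apply, hsv, hPv]
    have := x.2
    split_ifs <;> omega
  clear_value D O P
  refine key G D O s ⟨1, by omega⟩ hDG hOG hsG hsg ?_ ?_ ?_ ?_
  · intro h
    have := congrArg Fin.val h
    rw [hDv] at this
    simp only at this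
    split_ifs at this <;> omega
  · intro h
    have := congrArg Fin.val h
    rw [hOv] at this
    simp only at this
    split_ifs at this <;> omega
  · intro x hx
    have := x.2
    have hx' : x.val ≠ 1 := fun h => hx (Fin.ext h)
    rw [Fin.ext_iff, Fin.ext_iff, hDv, hOv]
    split_ifs <;> omega
  · intro B hB m1 m2 m3 x
    have hsB : ∀ y ∈ B, s y ∈ B := by
      refine hB s hsG _ m1 ?_
      convert m3 using 1
      ext
      have e1 := hsv ⟨1, by omega⟩
      have e2 := hOv ⟨1, by omega⟩
      rw [e1, e2, if_pos (by simp only; omega), if_neg (by simp), if_neg (by simp only; omega)]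
    have hsBp : ∀ t : ℕ, ∀ y ∈ B, (s ^ t) y ∈ B := by
      intro t
      induction t with
      | zero => intro y hy; simpa using hy
      | succ t ih => intro y hy; rw [pow_succ', Perm.mul_apply]; exact hsB _ (ih y hy)
    have hxn := x.2
    have hDv1 := hDv ⟨1, by omega⟩
    simp only [if_true] at hDv1
    by_cases hx : x.val % 2 = 0
    · by_cases hxk : k - 2 ≤ x.val
      · have := hsBp ((x.val - (k - 2)) / 2) _ m2
        convert this using 1
        ext
        rw [hpow _ (by omega), hDv1]
        split_ifs <;> omega
      · have := hsBp ((x.val + n + 1 - (k - 2)) / 2) _ m2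
        convert this using 1
        ext
        rw [hpow _ (by omega), hDv1]
        split_ifs <;> omega
    · have := hsBp ((x.val - 1) / 2) _ m1
      convert this using 1
      ext
      rw [hpow _ (by omega)]
      simp only
      split_ifs <;> omega

open Equiv Equiv.Perm in
theorem even_aux (n m j : ℕ) (hn : n = 2 * m) (hj1 : 1 ≤ j) (hj2 : j + 2 ≤ m)
    (G : Subgroup (Perm (Fin n))) (C V R : Perm (Fin n)) (hC : C ∈ G) (hV : V ∈ G) (hR : R ∈ G)
    (hsg : sign C = -1)
    (hCv : ∀ x : Fin n, (C x).val = if x.val + 1 < n then x.val + 1 else 0)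
    (hVv : ∀ x : Fin n, (V x).val = n - 1 - x.val)
    (hRv : ∀ x : Fin n, (R x).val = if x.val ≤ j then j - x.val else
      if m ≤ x.val ∧ x.val < m + j then n + j - 1 - x.val else x.val) : G = ⊤ := by
  have hpow : ∀ t : ℕ, t ≤ n → ∀ x : Fin n, ((C ^ t) x).val =
      if x.val + t < n then x.val + t else x.val + t - n := by
    intro t
    induction t with
    | zero => intro _ x; have := x.2; simp
    | succ t ih =>
      intro ht x
      rw [pow_succ', Perm.mul_apply, hCv, ih (by omega)]
      have := x.2
      split_ifs <;> omega
  have hpG : ∀ t : ℕ, C ^ t ∈ G := fun t => G.pow_mem hC t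
  have huniv : ∀ B : Set (Fin n), (∀ t ∈ G, ∀ x ∈ B, t x ∈ B → ∀ y ∈ B, t y ∈ B) →
      ∀ a b : Fin n, a ∈ B → b ∈ B → b.val = a.val + 1 → ∀ x, x ∈ B := by
    intro B hB a b ha hb hab x
    have hcl : ∀ y ∈ B, C y ∈ B := by
      refine hB C hC a ha ?_
      convert hb using 1
      ext
      rw [hCv, if_pos (by omega), hab]
    have hclp : ∀ t : ℕ, ∀ y ∈ B, (C ^ t) y ∈ B := by
      intro t
      induction t with
      | zero => intro y hy; simpa using hy
      | succ t ih => intro y hy; rw [pow_succ', Perm.mul_apply]; exact hcl _ (ih y hy)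
    have hx := x.2
    have ha2 := a.2
    by_cases hxa : a.val ≤ x.val
    · convert hclp (x.val - a.val) a ha using 1
      ext
      rw [hpow _ (by omega)]
      split_ifs <;> omega
    · convert hclp (x.val + n - a.val) a ha using 1
      ext
      rw [hpow _ (by omega)]
      split_ifs <;> omega
  by_cases hj : j = 1
  · subst hj
    set R' := C * R * C ^ (n - 1) with hR'
    have hR'G : R' ∈ G := G.mul_mem (G.mul_mem hC hR) (hpG _)
    have hR'v : ∀ x : Fin n, (R' x).val =
        if x.val = 1 then 2 else if x.val = 2 then 1 else x.val := by
      intro x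
      rw [hR', Perm.mul_apply, Perm.mul_apply, hCv, hRv, hpow _ (by omega)]
      have := x.2
      split_ifs <;> omega
    clear_value R'
    have v1 := hRv ⟨1, by omega⟩
    have v2 := hR'v ⟨1, by omega⟩
    simp only [le_refl, if_true, Nat.sub_self] at v1 v2
    refine key G R R' C ⟨1, by omega⟩ hR hR'G hC hsg ?_ ?_ ?_ ?_
    · intro h; rw [h] at v1; simp at v1
    · intro h; rw [h] at v2; simp at v2
    · intro x hx
      have := x.2
      have hx' : x.val ≠ 1 := fun h => hx (Fin.ext h)
      rw [Fin.ext_iff, Fin.ext_iff, hRv, hR'v]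
      split_ifs <;> omega
    · intro B hB m1 m2 m3
      exact huniv B hB _ _ m1 m3 v2
  · set h := C ^ (j + 1) * V * R with hh
    have hhG : h ∈ G := G.mul_mem (G.mul_mem (hpG _) hV) hR
    have hhv : ∀ x : Fin n, (h x).val = if x.val ≤ j then x.val else
        if m ≤ x.val ∧ x.val ≤ m + j then (if x.val = m + j then m else x.val + 1)
        else n + j - x.val := by
      intro x
      rw [hh, Perm.mul_apply, Perm.mul_apply, hpow _ (by omega), hVv, hRv]
      have := x.2
      split_ifs <;> omega
    clear_value h
    set g := h * h with hg
    have hgG : g ∈ G := G.mul_mem hhG hhG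
    have hgv : ∀ x : Fin n, (g x).val =
        if m ≤ x.val ∧ x.val ≤ m + j then (if x.val + 2 ≤ m + j then x.val + 2 else x.val + 1 - j)
        else x.val := by
      intro x
      rw [hg, Perm.mul_apply, hhv, hhv]
      have := x.2
      split_ifs <;> omega
    clear_value g
    set g0 := C ^ m * g * C ^ m with hg0
    have hg0G : g0 ∈ G := G.mul_mem (G.mul_mem (hpG _) hgG) (hpG _)
    have hg0v : ∀ x : Fin n, (g0 x).val =
        if x.val ≤ j then (if x.val + 2 ≤ j then x.val + 2 else x.val + 1 - j)
        else x.val := by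
      intro x
      rw [hg0, Perm.mul_apply, Perm.mul_apply, hpow _ (by omega), hgv, hpow _ (by omega)]
      have := x.2
      split_ifs <;> omega
    clear_value g0
    set g1 := C ^ j * g0 * C ^ (n - j) with hg1
    have hg1G : g1 ∈ G := G.mul_mem (G.mul_mem (hpG _) hg0G) (hpG _)
    have hg1v : ∀ x : Fin n, (g1 x).val =
        if j ≤ x.val ∧ x.val ≤ 2 * j then
          (if x.val + 2 ≤ 2 * j then x.val + 2 else x.val + 1 - j)
        else x.val := by
      intro x
      rw [hg1, Perm.mul_apply, Perm.mul_apply, hpow _ (by omega), hg0v, hpow _ (by omega)]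
      have := x.2
      split_ifs <;> omega
    clear_value g1
    have v1 := hg0v ⟨j, by omega⟩
    have v2 := hg1v ⟨j, by omega⟩
    simp only at v1 v2
    rw [if_pos le_rfl, if_neg (by omega)] at v1
    rw [if_pos (by omega), if_pos (by omega)] at v2
    refine key G g0 g1 C ⟨j, by omega⟩ hg0G hg1G hC hsg ?_ ?_ ?_ ?_
    · intro h; rw [h] at v1; simp only at v1; omega
    · intro h; rw [h] at v2; simp at v2
    · intro x hx
      have := x.2
      have hx' : x.val ≠ j := fun h => hx (Fin.ext h)
      rw [Fin.ext_iff, Fin.ext_iff, hg0v, hg1v]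
      split_ifs <;> omega
    · intro B hB m1 m2 m3
      have hcl : ∀ y ∈ B, (C ^ 2) y ∈ B := by
        refine hB (C ^ 2) (hpG 2) _ m1 ?_
        convert m3 using 1
        ext
        rw [hpow _ (by omega), v2]
        simp only
        split_ifs <;> omega
      have hclp : ∀ t : ℕ, ∀ y ∈ B, (C ^ (2 * t)) y ∈ B := by
        intro t
        induction t with
        | zero => intro y hy; simpa using hy
        | succ t ih =>
          intro y hy
          rw [show 2 * (t + 1) = 2 + 2 * t by ring, pow_add, Perm.mul_apply]
          exact hcl _ (ih y hy)
      have hhB : ∀ y ∈ B, h y ∈ B := by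
        refine hB h hhG _ m1 ?_
        convert m1 using 1
        ext
        rw [hhv]
        simp
      have hfin : ∀ a : Fin n, a.val = m ∨ a.val = m + 1 → a ∈ B → ∀ x, x ∈ B := by
        intro a ha haB
        refine huniv B hB a (h a) haB (hhB a haB) ?_
        rw [hhv]
        split_ifs <;> omega
      by_cases hp : (m - j) % 2 = 0
      · refine hfin _ ?_ (hclp ((m - j) / 2) _ m1)
        rw [hpow _ (by omega)]
        simp only
        split_ifs <;> omega
      · refine hfin _ ?_ (hclp ((m + 1 - j) / 2) _ m1)
        rw [hpow _ (by omega)]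
        simp only
        split_ifs <;> omega

/-- positions along the `n`-cycle -/
def posEquiv (m : ℕ) : Equiv.Perm (Fin (2 * m)) where
  toFun x := ⟨if x.val < m then 2 * x.val else 2 * (x.val - m) + 1, by
    have := x.2
    split_ifs <;> omega⟩
  invFun x := ⟨if x.val % 2 = 0 then x.val / 2 else m + x.val / 2, by
    have := x.2
    split_ifs <;> omega⟩
  left_inv x := by
    have := x.2
    ext
    simp only
    split_ifs <;> omega
  right_inv x := by
    have := x.2
    ext
    simp only
    split_ifs <;> omega

theorem posEquiv_val (m : ℕ) (x : Fin (2 * m)) : (posEquiv m x).val =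
    if x.val < m then 2 * x.val else 2 * (x.val - m) + 1 := rfl

theorem posEquiv_inv_val (m : ℕ) (x : Fin (2 * m)) : ((posEquiv m)⁻¹ x).val =
    if x.val % 2 = 0 then x.val / 2 else m + x.val / 2 := rfl

open Equiv Equiv.Perm in
theorem even_case (n k : ℕ) (hn : 5 ≤ n) (hk1 : 2 ≤ k) (hk2 : k < n - 2) (ho : n % 2 = 0)
    (he : k % 2 = 1) (G : Subgroup (Perm (Fin n))) (h1 : pr n n ∈ G) (h2 : pr n (n - 2) ∈ G)
    (h3 : pr n k ∈ G) : G = ⊤ := by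
  obtain ⟨m, rfl⟩ : ∃ m, n = 2 * m := ⟨n / 2, by omega⟩
  obtain ⟨j, rfl⟩ : ∃ j, k = 2 * j + 1 := ⟨k / 2, by omega⟩
  set φ := posEquiv m with hφ
  have hmem : ∀ g : Perm (Fin (2 * m)), g ∈ G →
      φ⁻¹ * g * φ ∈ G.comap (MulAut.conj φ).toMonoidHom := by
    intro g hg
    rw [Subgroup.mem_comap]
    have : (MulAut.conj φ).toMonoidHom (φ⁻¹ * g * φ) = g := by
      simp [MulAut.conj_apply, mul_assoc]
    rw [this]; exact hg
  have htop : G.comap (MulAut.conj φ).toMonoidHom = ⊤ := by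
    refine even_aux (2 * m) m j rfl (by omega) (by omega) _ _ _ _
      (hmem _ (G.mul_mem h1 h2)) (hmem _ h1) (hmem _ h3) ?_ ?_ ?_ ?_
    · rw [Perm.sign_mul, Perm.sign_mul, sign_s _ hn, sign_inv]
      rcases Int.units_eq_one_or (sign φ) with h | h <;> rw [h] <;> rfl
    · intro x
      rw [Perm.mul_apply, Perm.mul_apply, hφ, posEquiv_inv_val, s_val _ hn, posEquiv_val]
      have := x.2
      split_ifs <;> omega
    · intro x
      rw [Perm.mul_apply, Perm.mul_apply, hφ, posEquiv_inv_val, pr_val _ _ le_rfl, posEquiv_val]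
      have := x.2
      split_ifs <;> omega
    · intro x
      rw [Perm.mul_apply, Perm.mul_apply, hφ, posEquiv_inv_val, pr_val _ _ (by omega),
        posEquiv_val]
      have := x.2
      split_ifs <;> omega
  rw [eq_top_iff]
  intro g _
  have : φ⁻¹ * g * φ ∈ G.comap (MulAut.conj φ).toMonoidHom := by rw [htop]; trivial
  rw [Subgroup.mem_comap] at this
  have e : (MulAut.conj φ).toMonoidHom (φ⁻¹ * g * φ) = g := by
    simp [MulAut.conj_apply, mul_assoc]
  rwa [e] at this

open Equiv Equiv.Perm in
theorem rel_closed {n : ℕ} (S : Set (Perm (Fin n))) (q : ℕ → ℕ)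
    (hS : ∀ g ∈ S, ∀ x y : Fin n, q x.val = q y.val ↔ q (g x).val = q (g y).val)
    (g : Perm (Fin n)) (hg : g ∈ Subgroup.closure S) :
    ∀ x y : Fin n, q x.val = q y.val ↔ q (g x).val = q (g y).val := by
  induction hg using Subgroup.closure_induction with
  | mem g hg => exact hS g hg
  | one => intro x y; rfl
  | mul a b _ _ ha hb =>
    intro x y
    rw [hb x y, ha (b x) (b y)]; rfl
  | inv a _ ha =>
    intro x y
    rw [ha (a⁻¹ x) (a⁻¹ y)]
    simp

theorem stmt19 (n k : ℕ) (hn : 5 ≤ n) (hk1 : 2 ≤ k) (hk2 : k < n - 2) :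
    Subgroup.closure ({pr n n, pr n (n - 2), pr n k} : Set (Equiv.Perm (Fin n))) = ⊤ ↔
      n % 2 ≠ k % 2 := by
  constructor
  · intro htop hpar
    rcases Nat.mod_two_eq_zero_or_one n with h | h
    · have := rel_closed (q := fun x => x / 2) (S := {pr n n, pr n (n - 2), pr n k}) (by
        intro g hg x y
        have hx := x.2
        have hy := y.2
        simp only [Set.mem_insert_iff, Set.mem_singleton_iff] at hg
        rcases hg with rfl | rfl | rfl <;>
          rw [pr_val n _ (by omega), pr_val n _ (by omega)] <;> split_ifs <;> omega)
        (Equiv.swap ⟨0, by omega⟩ ⟨2, by omega⟩) (by rw [htop]; trivial)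
        ⟨0, by omega⟩ ⟨1, by omega⟩
      simp [Equiv.swap_apply_def] at this
    · have := rel_closed (q := fun x => x % 2) (S := {pr n n, pr n (n - 2), pr n k}) (by
        intro g hg x y
        have hx := x.2
        have hy := y.2
        simp only [Set.mem_insert_iff, Set.mem_singleton_iff] at hg
        rcases hg with rfl | rfl | rfl <;>
          rw [pr_val n _ (by omega), pr_val n _ (by omega)] <;> split_ifs <;> omega)
        (Equiv.swap ⟨0, by omega⟩ ⟨1, by omega⟩) (by rw [htop]; trivial)
        ⟨0, by omega⟩ ⟨2, by omega⟩
      simp [Equiv.swap_apply_def] at this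
  · intro hpar
    have m1 : pr n n ∈ Subgroup.closure
        ({pr n n, pr n (n - 2), pr n k} : Set (Equiv.Perm (Fin n))) :=
      Subgroup.subset_closure (by simp)
    have m2 : pr n (n - 2) ∈ Subgroup.closure
        ({pr n n, pr n (n - 2), pr n k} : Set (Equiv.Perm (Fin n))) :=
      Subgroup.subset_closure (by simp)
    have m3 : pr n k ∈ Subgroup.closure
        ({pr n n, pr n (n - 2), pr n k} : Set (Equiv.Perm (Fin n))) :=
      Subgroup.subset_closure (by simp)
    rcases Nat.mod_two_eq_zero_or_one n with h | h
    · exact even_case n k hn hk1 hk2 h (by omega) _ m1 m2 m3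
    · exact odd_case n k hn hk1 hk2 h (by omega) _ m1 m2 m3
end
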